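/- arXiv:2403.16636 — 2 statements merged into one kernel-verified Lean document; each statement's English description precedes it below -/
import Mathlib

section
/- Fix an integer n ≥ 2 and define, for u : U → ℂⁿ analytic, F₁(u) := ( I_0(u) − ((n+2)/(2n))·I_n(u)² ) / ( I_{n−1}(u) + ((n−1)/(2(n+1)))·I_n(u)² ). Let q : V → ℂⁿ be analytic on an open set V ⊆ ℂ and let φ(z) = (az+b)/(cz+d) be a Möbius transformation (ad − bc ≠ 0). Then F₁ is Möbius-commuting: for every z ∈ ℂ with cz + d ≠ 0, φ(z) ∈ V, Δ(q)(φ(z)) ≠ 0, and both denominators I_{n−1}(q∘φ)(z) + ((n−1)/(2(n+1)))·I_n(q∘φ)(z)² and I_{n−1}(q)(φ(z)) + ((n−1)/(2(n+1)))·I_n(q)(φ(z))² nonzero, one has F₁(q ∘ φ)(z) = F₁(q)(φ(z)). -/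
/-- `D(u)(z)`: the `n×n` matrix whose columns are `u'(z), u''(z), …, u⁽ⁿ⁾(z)`. -/
noncomputable def Dmat (n : ℕ) (u : ℂ → (Fin n → ℂ)) (z : ℂ) : Matrix (Fin n) (Fin n) ℂ :=
  Matrix.of fun (i j : Fin n) => iteratedDeriv (j.1 + 1) u z i

/-- `Δ(u)(z) := det D(u)(z)`. -/
noncomputable def Δmat (n : ℕ) (u : ℂ → (Fin n → ℂ)) (z : ℂ) : ℂ :=
  (Dmat n u z).det

/-- `A_i(u)(z)`: the determinant obtained from `Δ(u)(z)` by replacing the column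
`u⁽ⁱ⁾(z)` with `u⁽ⁿ⁺¹⁾(z)` (the index `i : Fin n` encodes `i+1 ∈ {1,…,n}`). -/
noncomputable def Ainv (n : ℕ) (u : ℂ → (Fin n → ℂ)) (i : Fin n) (z : ℂ) : ℂ :=
  (Matrix.of fun (r j : Fin n) =>
    if j = i then iteratedDeriv (n + 1) u z r else iteratedDeriv (j.1 + 1) u z r).det

/-- `I_i(u)(z) := A_i(u)(z)/Δ(u)(z)` (the index `i : Fin n` encodes `i+1 ∈ {1,…,n}`). -/
noncomputable def Iinv (n : ℕ) (u : ℂ → (Fin n → ℂ)) (i : Fin n) (z : ℂ) : ℂ :=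
  Ainv n u i z / Δmat n u z

/-- `I_0(u)(z) := det[u'(z), …, u⁽ⁿ⁻¹⁾(z), u⁽ⁿ⁺²⁾(z)] / Δ(u)(z)`. -/
noncomputable def I0inv (n : ℕ) (u : ℂ → (Fin n → ℂ)) (z : ℂ) : ℂ :=
  (Matrix.of fun (r j : Fin n) =>
    if j.1 = n - 1 then iteratedDeriv (n + 2) u z r else iteratedDeriv (j.1 + 1) u z r).det /
    Δmat n u z

/-- The unsigned Lah numbers, through their recursion. -/
def lahNumber : ℕ → ℕ → ℕ
  | 0, 0 => 1
  | 0, _ + 1 => 0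
  | k + 1, 0 => k * lahNumber k 0
  | k + 1, j + 1 => (k + j + 1) * lahNumber k (j + 1) + lahNumber k j

theorem lahNumber_succ_zero (k : ℕ) : lahNumber (k + 1) 0 = 0 := by
  induction k with
  | zero => simp [lahNumber]
  | succ k ih => rw [lahNumber, ih, mul_zero]

theorem lahNumber_eq_zero_of_lt {k j : ℕ} (h : k < j) : lahNumber k j = 0 := by
  induction k generalizing j with
  | zero =>
    obtain ⟨j, rfl⟩ := Nat.exists_eq_succ_of_ne_zero (by omega : j ≠ 0)
    rfl
  | succ k ih =>
    obtain ⟨j, rfl⟩ := Nat.exists_eq_succ_of_ne_zero (by omega : j ≠ 0)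
    rw [Nat.succ_eq_add_one, lahNumber, ih (by omega), ih (by omega), mul_zero]

theorem lahNumber_self (k : ℕ) : lahNumber k k = 1 := by
  induction k with
  | zero => rfl
  | succ k ih => rw [lahNumber, ih, lahNumber_eq_zero_of_lt (by omega), mul_zero, zero_add]

theorem lahNumber_succ_self (k : ℕ) : lahNumber (k + 1) k = k * (k + 1) := by
  induction k with
  | zero => rfl
  | succ k ih => rw [lahNumber, ih, lahNumber_self]; ring

theorem two_mul_lahNumber_add_two_self (k : ℕ) :
    2 * lahNumber (k + 2) k = k * (k + 1) ^ 2 * (k + 2) := by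
  induction k with
  | zero => rfl
  | succ k ih => rw [lahNumber, mul_add, ih, lahNumber_succ_self]; ring

/-- The coefficient of `q⁽ʲ⁾ ∘ φ` in the `k`-th derivative of `q ∘ φ`, where `s` is the
derivative of the Möbius map `φ` and `2 * t` is the logarithmic derivative of `s`. -/
noncomputable def moebiusCoeff (s t : ℂ) (k j : ℕ) : ℂ :=
  lahNumber k j * t ^ (k - j) * s ^ j

theorem moebiusCoeff_eq_zero_of_lt (s t : ℂ) {k j : ℕ} (h : k < j) : moebiusCoeff s t k j = 0 := by
  simp [moebiusCoeff, lahNumber_eq_zero_of_lt h]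

theorem moebiusCoeff_self (s t : ℂ) (k : ℕ) : moebiusCoeff s t k k = s ^ k := by
  simp [moebiusCoeff, lahNumber_self]

theorem moebiusCoeff_succ_self (s t : ℂ) (k : ℕ) :
    moebiusCoeff s t (k + 1) k = k * (k + 1) * t * s ^ k := by
  simp [moebiusCoeff, lahNumber_succ_self]

theorem moebiusCoeff_add_two_self (s t : ℂ) (k : ℕ) :
    moebiusCoeff s t (k + 2) k = k * (k + 1) ^ 2 * (k + 2) / 2 * t ^ 2 * s ^ k := by
  have h : (2 : ℂ) * lahNumber (k + 2) k = k * (k + 1) ^ 2 * (k + 2) := by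
    exact_mod_cast two_mul_lahNumber_add_two_self k
  rw [← h, moebiusCoeff, Nat.add_sub_cancel_left]
  ring

theorem sum_moebiusCoeff_succ {E : Type*} [AddCommGroup E] [Module ℂ E] (s t : ℂ) (p : ℕ → E)
    (k : ℕ) :
    ∑ j ∈ Finset.range (k + 2), moebiusCoeff s t (k + 1) j • p j =
      ∑ j ∈ Finset.range (k + 1), (((k + j : ℂ) * t * moebiusCoeff s t k j) • p j +
        (moebiusCoeff s t k j * s) • p (j + 1)) := by
  have h : ∑ j ∈ Finset.range (k + 1), ((k + j : ℂ) * t * moebiusCoeff s t k j) • p j =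
      ∑ j ∈ Finset.range (k + 2), ((k + j : ℂ) * t * moebiusCoeff s t k j) • p j := by
    rw [Finset.sum_range_succ _ (k + 1), moebiusCoeff_eq_zero_of_lt s t k.lt_succ_self]
    simp
  rw [Finset.sum_add_distrib, h, Finset.sum_range_succ', Finset.sum_range_succ' _ (k + 1),
    add_right_comm, ← Finset.sum_add_distrib]
  congr 1
  · refine Finset.sum_congr rfl fun j hj => ?_
    rw [← add_smul]
    congr 1
    have hjk : j ≤ k := Nat.lt_succ_iff.mp (Finset.mem_range.mp hj)
    rcases hjk.eq_or_lt with rfl | hlt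
    · rw [moebiusCoeff_self, moebiusCoeff_self, moebiusCoeff_eq_zero_of_lt s t j.lt_succ_self]
      ring
    · obtain ⟨e, rfl⟩ := Nat.exists_eq_add_of_lt hlt
      have h1 : j + e + 1 + 1 - (j + 1) = e + 1 := by omega
      have h2 : j + e + 1 - (j + 1) = e := by omega
      have h3 : j + e + 1 - j = e + 1 := by omega
      simp only [moebiusCoeff, lahNumber, h1, h2, h3]
      push_cast
      ring
  · congr 1
    cases k with
    | zero => simp [moebiusCoeff, lahNumber]
    | succ k => simp [moebiusCoeff, lahNumber_succ_zero]

theorem hasDerivAt_moebiusCoeff {s t : ℂ → ℂ} {z : ℂ} (hs : HasDerivAt s (2 * t z * s z) z)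
    (ht : HasDerivAt t (t z ^ 2) z) {k j : ℕ} (hjk : j ≤ k) :
    HasDerivAt (fun x => moebiusCoeff (s x) (t x) k j)
      ((k + j : ℂ) * t z * moebiusCoeff (s z) (t z) k j) z := by
  obtain ⟨e, rfl⟩ := Nat.exists_eq_add_of_le hjk
  have h := ((ht.fun_pow e).const_mul (lahNumber (j + e) j : ℂ)).fun_mul (hs.fun_pow j)
  simp only [moebiusCoeff, Nat.add_sub_cancel_left]
  refine h.congr_deriv ?_
  rcases e with _ | e <;> rcases j with _ | j <;> simp <;> ring

theorem iteratedDeriv_comp_eq_sum_moebiusCoeff {E : Type*} [NormedAddCommGroup E] [NormedSpace ℂ E]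
    [CompleteSpace E] {q : ℂ → E} {φ s t : ℂ → ℂ} {W : Set ℂ} (hW : IsOpen W)
    (hq : ∀ z ∈ W, AnalyticAt ℂ q (φ z)) (hφ : ∀ z ∈ W, HasDerivAt φ (s z) z)
    (hs : ∀ z ∈ W, HasDerivAt s (2 * t z * s z) z) (ht : ∀ z ∈ W, HasDerivAt t (t z ^ 2) z)
    (k : ℕ) {z : ℂ} (hz : z ∈ W) :
    iteratedDeriv k (q ∘ φ) z =
      ∑ j ∈ Finset.range (k + 1), moebiusCoeff (s z) (t z) k j • iteratedDeriv j q (φ z) := by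
  induction k generalizing z with
  | zero => simp [moebiusCoeff_self]
  | succ k ih =>
    have hev : iteratedDeriv k (q ∘ φ) =ᶠ[nhds z] fun x =>
        ∑ j ∈ Finset.range (k + 1), moebiusCoeff (s x) (t x) k j • iteratedDeriv j q (φ x) := by
      filter_upwards [hW.mem_nhds hz] with x hx using ih hx
    rw [iteratedDeriv_succ, hev.deriv_eq, sum_moebiusCoeff_succ]
    refine (HasDerivAt.fun_sum fun j hj => ?_).deriv
    have hd : HasDerivAt (iteratedDeriv j q) (iteratedDeriv (j + 1) q (φ z)) (φ z) := by
      rw [iteratedDeriv_succ, iteratedDeriv_eq_iterate]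
      exact ((hq z hz).iterated_deriv j).differentiableAt.hasDerivAt
    have hc := hasDerivAt_moebiusCoeff (hs z hz) (ht z hz)
      (Nat.lt_succ_iff.mp (Finset.mem_range.mp hj))
    refine (hc.fun_smul (hd.scomp z (hφ z hz))).congr_deriv ?_
    rw [smul_smul, add_comm]
    rfl

section Frame

open scoped Matrix

theorem det_replaceCol_eq_cramer (n : ℕ) (u : ℂ → (Fin n → ℂ)) (z : ℂ) (v : Fin n → ℂ)
    (i : Fin n) (P : Fin n → Prop) [DecidablePred P] (hP : ∀ j, P j ↔ j = i) :
    (Matrix.of fun (r j : Fin n) => if P j then v r else iteratedDeriv (j.1 + 1) u z r).det =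
      (Dmat n u z).cramer v i := by
  rw [Matrix.cramer_apply]
  congr 1
  ext r j
  simp [Matrix.updateCol_apply, Dmat, hP]

theorem Dmat_mulVec (n : ℕ) (u : ℂ → (Fin n → ℂ)) (z : ℂ) (x : Fin n → ℂ) :
    Dmat n u z *ᵥ x = ∑ j : Fin n, x j • iteratedDeriv (j.1 + 1) u z := by
  ext r
  simp [Matrix.mulVec, dotProduct, Dmat, mul_comm]

theorem Dmat_mulVec_cramer_div (n : ℕ) (u : ℂ → (Fin n → ℂ)) (z : ℂ) (hΔ : Δmat n u z ≠ 0)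
    (v : Fin n → ℂ) : Dmat n u z *ᵥ (fun i => (Dmat n u z).cramer v i / Δmat n u z) = v := by
  have h : (fun i => (Dmat n u z).cramer v i / Δmat n u z) =
      (Δmat n u z)⁻¹ • (Dmat n u z).cramer v := by
    ext i
    simp [div_eq_inv_mul]
  rw [h, Matrix.mulVec_smul, Matrix.mulVec_cramer, smul_smul]
  exact (congrArg (· • v) (inv_mul_cancel₀ hΔ)).trans (one_smul ℂ v)

theorem Dmat_mulVec_Iinv (n : ℕ) (u : ℂ → (Fin n → ℂ)) (z : ℂ) (hΔ : Δmat n u z ≠ 0) :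
    Dmat n u z *ᵥ (fun i => Iinv n u i z) = iteratedDeriv (n + 1) u z := by
  rw [← Dmat_mulVec_cramer_div n u z hΔ (iteratedDeriv (n + 1) u z)]
  congr 1
  ext i
  rw [Iinv, Ainv, det_replaceCol_eq_cramer n u z _ i _ fun _ => Iff.rfl]

theorem exists_Dmat_mulVec_eq_I0inv (m : ℕ) (u : ℂ → (Fin (m + 1) → ℂ)) (z : ℂ)
    (hΔ : Δmat (m + 1) u z ≠ 0) :
    ∃ x, Dmat (m + 1) u z *ᵥ x = iteratedDeriv (m + 3) u z ∧
      x (Fin.last m) = I0inv (m + 1) u z := by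
  refine ⟨_, Dmat_mulVec_cramer_div _ u z hΔ _, ?_⟩
  rw [I0inv, det_replaceCol_eq_cramer _ u z _ (Fin.last m)]
  intro j
  simp [Fin.ext_iff]

/-- The change-of-frame matrix from the first `n` derivatives of `q` to those of `q ∘ φ`. -/
noncomputable def moebiusMatrix (n : ℕ) (s t : ℂ) : Matrix (Fin n) (Fin n) ℂ :=
  Matrix.of fun i j => moebiusCoeff s t (j.1 + 1) (i.1 + 1)

theorem det_moebiusMatrix_ne_zero (n : ℕ) {s : ℂ} (t : ℂ) (hs : s ≠ 0) :
    (moebiusMatrix n s t).det ≠ 0 := by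
  rw [Matrix.det_of_isUpperTriangular]
  · refine Finset.prod_ne_zero_iff.mpr fun i _ => ?_
    rw [moebiusMatrix, Matrix.of_apply, moebiusCoeff_self]
    exact pow_ne_zero _ hs
  · intro i j hij
    exact moebiusCoeff_eq_zero_of_lt s t (Nat.succ_lt_succ hij)

theorem moebiusMatrix_mulVec_last (m : ℕ) (s t : ℂ) (x : Fin (m + 2) → ℂ) :
    (moebiusMatrix (m + 2) s t *ᵥ x) (Fin.last (m + 1)) = s ^ (m + 2) * x (Fin.last (m + 1)) := by
  rw [Matrix.mulVec, dotProduct, Finset.sum_eq_single (Fin.last (m + 1))]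
  · simp [moebiusMatrix, moebiusCoeff_self]
  · intro j _ hj
    have hlt : j.1 < m + 1 := Fin.val_lt_last hj
    simp [moebiusMatrix, moebiusCoeff_eq_zero_of_lt s t (Nat.succ_lt_succ hlt)]
  · simp

theorem moebiusMatrix_mulVec_penultimate (m : ℕ) (s t : ℂ) (x : Fin (m + 2) → ℂ) :
    (moebiusMatrix (m + 2) s t *ᵥ x) (Fin.last m).castSucc =
      s ^ (m + 1) * x (Fin.last m).castSucc +
        (m + 1) * (m + 2) * t * s ^ (m + 1) * x (Fin.last (m + 1)) := by
  rw [Matrix.mulVec, dotProduct, Fin.sum_univ_castSucc, Finset.sum_eq_single (Fin.last m)]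
  · simp only [moebiusMatrix, Matrix.of_apply, Fin.val_castSucc, Fin.val_last, moebiusCoeff_self,
      moebiusCoeff_succ_self]
    push_cast
    ring
  · intro j _ hj
    have hlt : j.1 < m := Fin.val_lt_last hj
    simp [moebiusMatrix, moebiusCoeff_eq_zero_of_lt s t (Nat.succ_lt_succ hlt)]
  · simp

theorem sum_moebiusCoeff_eq {E : Type*} [AddCommGroup E] [Module ℂ E] (s t : ℂ) (p : ℕ → E)
    {k N : ℕ} (hkN : k ≤ N) :
    ∑ j ∈ Finset.range (k + 2), moebiusCoeff s t (k + 1) j • p j =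
      ∑ j ∈ Finset.range (N + 1), moebiusCoeff s t (k + 1) (j + 1) • p (j + 1) := by
  have h0 : moebiusCoeff s t (k + 1) 0 = 0 := by simp [moebiusCoeff, lahNumber_succ_zero]
  rw [Finset.sum_range_succ', h0, zero_smul, add_zero]
  refine Finset.sum_subset (Finset.range_mono (by omega)) fun j _ hj => ?_
  rw [Finset.mem_range, not_lt] at hj
  rw [moebiusCoeff_eq_zero_of_lt s t (by omega), zero_smul]

theorem Iinv_I0inv_of_moebius_frame (m : ℕ) (u q : ℂ → (Fin (m + 2) → ℂ)) (z w s t : ℂ)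
    (hs : s ≠ 0) (hΔ : Δmat (m + 2) q w ≠ 0)
    (hu : ∀ k, iteratedDeriv k u z =
      ∑ j ∈ Finset.range (k + 1), moebiusCoeff s t k j • iteratedDeriv j q w) :
    Iinv (m + 2) u (Fin.last (m + 1)) z =
        s * Iinv (m + 2) q (Fin.last (m + 1)) w + (m + 2) * (m + 3) * t ∧
      Iinv (m + 2) u (Fin.last m).castSucc z =
        s ^ 2 * Iinv (m + 2) q (Fin.last m).castSucc w
          - (m + 1) * (m + 2) * t * s * Iinv (m + 2) q (Fin.last (m + 1)) w
          - (m + 1) * (m + 2) ^ 2 * (m + 3) / 2 * t ^ 2 ∧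
      I0inv (m + 2) u z = s ^ 2 * I0inv (m + 2) q w
          + (m + 3) * (m + 4) * t * s * Iinv (m + 2) q (Fin.last (m + 1)) w
          + (m + 2) * (m + 3) ^ 2 * (m + 4) / 2 * t ^ 2 := by
  set P := Dmat (m + 2) q w with hP
  set T := moebiusMatrix (m + 2) s t with hT
  have hPT : Dmat (m + 2) u z = P * T := by
    ext r j
    have h := congrFun (hu (j.1 + 1)) r
    rw [sum_moebiusCoeff_eq s t _ (Nat.lt_succ_iff.mp j.2), Finset.sum_range] at h
    rw [Matrix.mul_apply]
    refine h.trans ?_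
    simp [hP, hT, Dmat, moebiusMatrix, mul_comm]
  have hΔu : Δmat (m + 2) u z ≠ 0 := by
    rw [Δmat, hPT, Matrix.det_mul]
    exact mul_ne_zero hΔ (det_moebiusMatrix_ne_zero _ t hs)
  have hinj : Function.Injective P.mulVec :=
    Matrix.mulVec_injective_of_isUnit ((Matrix.isUnit_iff_isUnit_det _).mpr hΔ.isUnit)
  set x : Fin (m + 2) → ℂ := fun i => Iinv (m + 2) q i w with hx
  set y : Fin (m + 2) → ℂ := fun i => Iinv (m + 2) u i z with hy
  have hPx : P *ᵥ x = iteratedDeriv (m + 3) q w := Dmat_mulVec_Iinv _ q w hΔ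
  have hUy : Dmat (m + 2) u z *ᵥ y = iteratedDeriv (m + 3) u z := Dmat_mulVec_Iinv _ u z hΔu
  obtain ⟨x', hPx', hx'⟩ := exists_Dmat_mulVec_eq_I0inv (m + 1) q w hΔ
  obtain ⟨y', hUy', hy'⟩ := exists_Dmat_mulVec_eq_I0inv (m + 1) u z hΔu
  have hTy : T *ᵥ y = (fun i => moebiusCoeff s t (m + 3) (i.1 + 1)) + s ^ (m + 3) • x := by
    apply hinj
    rw [Matrix.mulVec_mulVec, ← hPT, hUy, Matrix.mulVec_add, Matrix.mulVec_smul, hPx, hP,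
      Dmat_mulVec, hu, sum_moebiusCoeff_eq s t _ le_rfl, Finset.sum_range_succ, moebiusCoeff_self,
      Finset.sum_range]
  have hTy' : T *ᵥ y' = (fun i => moebiusCoeff s t (m + 4) (i.1 + 1)) +
      moebiusCoeff s t (m + 4) (m + 3) • x + s ^ (m + 4) • x' := by
    apply hinj
    rw [Matrix.mulVec_mulVec, ← hPT, hUy', Matrix.mulVec_add, Matrix.mulVec_add,
      Matrix.mulVec_smul, Matrix.mulVec_smul, hPx, hPx', hP, Dmat_mulVec, hu,
      sum_moebiusCoeff_eq s t _ le_rfl, Finset.sum_range_succ, Finset.sum_range_succ,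
      moebiusCoeff_self, Finset.sum_range]
  have e1 := congrFun hTy (Fin.last (m + 1))
  have e2 := congrFun hTy (Fin.last m).castSucc
  have e3 := congrFun hTy' (Fin.last (m + 1))
  rw [hT, moebiusMatrix_mulVec_last] at e1 e3
  rw [hT, moebiusMatrix_mulVec_penultimate] at e2
  have c1 := moebiusCoeff_succ_self s t (m + 2)
  have c2 := moebiusCoeff_add_two_self s t (m + 1)
  have c3 := moebiusCoeff_add_two_self s t (m + 2)
  have c4 := moebiusCoeff_succ_self s t (m + 3)
  simp only [Pi.add_apply, Pi.smul_apply, smul_eq_mul, Fin.val_last, Fin.val_castSucc] at e1 e2 e3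
  rw [hx', hy'] at e3
  push_cast at c1 c2 c3 c4
  rw [c1] at e1
  rw [c2] at e2
  rw [c3, c4] at e3
  have g1 : y (Fin.last (m + 1)) = s * x (Fin.last (m + 1)) + (m + 2) * (m + 3) * t := by
    apply mul_left_cancel₀ (pow_ne_zero (m + 2) hs)
    rw [e1]
    ring
  refine ⟨g1, ?_, ?_⟩
  · change y _ = s ^ 2 * x _ - _ * x _ - _
    rw [g1] at e2
    apply mul_left_cancel₀ (pow_ne_zero (m + 1) hs)
    linear_combination e2
  · change _ = _ + _ * x _ + _
    apply mul_left_cancel₀ (pow_ne_zero (m + 2) hs)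
    linear_combination e3

end Frame

/-- the invariant
`F₁(u) = (I_0(u) − ((n+2)/(2n))·I_n(u)²)/(I_{n−1}(u) + ((n−1)/(2(n+1)))·I_n(u)²)`
is Möbius-commuting: `F₁(q ∘ φ)(z) = F₁(q)(φ(z))`. -/
theorem F1_moebius_commuting (n : ℕ) (hn : 2 ≤ n) (V : Set ℂ) (hV : IsOpen V)
    (q : ℂ → (Fin n → ℂ)) (hq : ∀ w ∈ V, AnalyticAt ℂ q w)
    (a b c d : ℂ) (h : a * d - b * c ≠ 0)
    (φ : ℂ → ℂ) (hφ : ∀ z, φ z = (a * z + b) / (c * z + d))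
    (z : ℂ) (hz : c * z + d ≠ 0) (hzV : φ z ∈ V) (hΔ : Δmat n q (φ z) ≠ 0)
    (hden₁ : Iinv n (q ∘ φ) ⟨n - 2, by omega⟩ z +
        ((n : ℂ) - 1) / (2 * ((n : ℂ) + 1)) * (Iinv n (q ∘ φ) ⟨n - 1, by omega⟩ z) ^ 2 ≠ 0)
    (hden₂ : Iinv n q ⟨n - 2, by omega⟩ (φ z) +
        ((n : ℂ) - 1) / (2 * ((n : ℂ) + 1)) * (Iinv n q ⟨n - 1, by omega⟩ (φ z)) ^ 2 ≠ 0) :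
    (I0inv n (q ∘ φ) z - ((n : ℂ) + 2) / (2 * n) * (Iinv n (q ∘ φ) ⟨n - 1, by omega⟩ z) ^ 2) /
        (Iinv n (q ∘ φ) ⟨n - 2, by omega⟩ z +
          ((n : ℂ) - 1) / (2 * ((n : ℂ) + 1)) * (Iinv n (q ∘ φ) ⟨n - 1, by omega⟩ z) ^ 2) =
      (I0inv n q (φ z) - ((n : ℂ) + 2) / (2 * n) * (Iinv n q ⟨n - 1, by omega⟩ (φ z)) ^ 2) /
        (Iinv n q ⟨n - 2, by omega⟩ (φ z) +
          ((n : ℂ) - 1) / (2 * ((n : ℂ) + 1)) * (Iinv n q ⟨n - 1, by omega⟩ (φ z)) ^ 2) := by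
  set s : ℂ → ℂ := fun x => (a * d - b * c) / (c * x + d) ^ 2 with hs_def
  set t : ℂ → ℂ := fun x => -c / (c * x + d) with ht_def
  have hlin : ∀ x, HasDerivAt (fun x => c * x + d) c x := fun x => by
    simpa using ((hasDerivAt_id x).const_mul c).add_const d
  have hderiv : ∀ x, c * x + d ≠ 0 → HasDerivAt φ (s x) x := by
    intro x hx
    have hnum : HasDerivAt (fun x => a * x + b) a x := by
      simpa using ((hasDerivAt_id x).const_mul a).add_const b
    rw [funext hφ]
    refine (hnum.fun_div (hlin x) hx).congr_deriv ?_
    simp only [hs_def]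
    ring
  have hderiv_s : ∀ x, c * x + d ≠ 0 → HasDerivAt s (2 * t x * s x) x := by
    intro x hx
    refine ((hasDerivAt_const x (a * d - b * c)).fun_div ((hlin x).fun_pow 2)
      (pow_ne_zero 2 hx)).congr_deriv ?_
    simp only [hs_def, ht_def]
    field_simp
    ring
  have hderiv_t : ∀ x, c * x + d ≠ 0 → HasDerivAt t (t x ^ 2) x := by
    intro x hx
    refine ((hasDerivAt_const x (-c)).fun_div (hlin x) hx).congr_deriv ?_
    simp only [ht_def]
    field_simp
    ring
  have hU : IsOpen {x : ℂ | c * x + d ≠ 0} := isOpen_ne_fun (by fun_prop) (by fun_prop)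
  have hW : IsOpen ({x : ℂ | c * x + d ≠ 0} ∩ φ ⁻¹' V) :=
    ContinuousOn.isOpen_inter_preimage
      (fun x hx => (hderiv x hx).continuousAt.continuousWithinAt) hU hV
  have hu := fun k => iteratedDeriv_comp_eq_sum_moebiusCoeff hW (fun x hx => hq _ hx.2)
    (fun x hx => hderiv x hx.1) (fun x hx => hderiv_s x hx.1) (fun x hx => hderiv_t x hx.1) k
    (z := z) ⟨hz, hzV⟩
  have hsz : s z ≠ 0 := div_ne_zero h (pow_ne_zero 2 hz)
  obtain ⟨m, rfl⟩ := Nat.exists_eq_add_of_le' hn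
  obtain ⟨h1, h2, h3⟩ := Iinv_I0inv_of_moebius_frame m (q ∘ φ) q z (φ z) (s z) (t z) hsz hΔ hu
  have i1 : (⟨m + 2 - 1, by omega⟩ : Fin (m + 2)) = Fin.last (m + 1) := rfl
  have i2 : (⟨m + 2 - 2, by omega⟩ : Fin (m + 2)) = (Fin.last m).castSucc := rfl
  rw [i1, i2]
  have hm2 : (m : ℂ) + 2 ≠ 0 := by exact_mod_cast (by omega : m + 2 ≠ 0)
  have hm3 : (m : ℂ) + 2 + 1 ≠ 0 := by exact_mod_cast (by omega : m + 2 + 1 ≠ 0)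
  have hnum : I0inv (m + 2) (q ∘ φ) z - (((m + 2 : ℕ) : ℂ) + 2) / (2 * ((m + 2 : ℕ) : ℂ)) *
        Iinv (m + 2) (q ∘ φ) (Fin.last (m + 1)) z ^ 2 =
      s z ^ 2 * (I0inv (m + 2) q (φ z) - (((m + 2 : ℕ) : ℂ) + 2) / (2 * ((m + 2 : ℕ) : ℂ)) *
        Iinv (m + 2) q (Fin.last (m + 1)) (φ z) ^ 2) := by
    rw [h1, h3]
    push_cast
    field_simp
    ring
  have hden : Iinv (m + 2) (q ∘ φ) (Fin.last m).castSucc z +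
        (((m + 2 : ℕ) : ℂ) - 1) / (2 * (((m + 2 : ℕ) : ℂ) + 1)) *
          Iinv (m + 2) (q ∘ φ) (Fin.last (m + 1)) z ^ 2 =
      s z ^ 2 * (Iinv (m + 2) q (Fin.last m).castSucc (φ z) +
        (((m + 2 : ℕ) : ℂ) - 1) / (2 * (((m + 2 : ℕ) : ℂ) + 1)) *
          Iinv (m + 2) q (Fin.last (m + 1)) (φ z) ^ 2) := by
    rw [h1, h2]
    push_cast
    field_simp
    ring
  rw [hnum, hden, mul_div_mul_left _ _ (pow_ne_zero 2 hsz)]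
end

section
/- Let n = 3 and define, for u : U → ℂ³ analytic, F₁(u) := (6·I₀(u) − 5·I₃(u)²)/(4·I₂(u) + I₃(u)²) and F₂(u) := (36·I₁(u) + 6·I₂(u)·I₃(u) + I₃(u)³)² / (4·I₂(u) + I₃(u)²)³. Let q : V → ℂ³ be analytic on an open set V ⊆ ℂ and let φ(z) = (az+b)/(cz+d) be a Möbius transformation (ad − bc ≠ 0). Then F₁ and F₂ are Möbius-commuting: for every z ∈ ℂ with cz + d ≠ 0, φ(z) ∈ V, Δ(q)(φ(z)) ≠ 0, and with 4·I₂(q∘φ)(z) + I₃(q∘φ)(z)² ≠ 0 and 4·I₂(q)(φ(z)) + I₃(q)(φ(z))² ≠ 0, one has F₁(q ∘ φ)(z) = F₁(q)(φ(z)) and F₂(q ∘ φ)(z) = F₂(q)(φ(z)). -/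
/-- `F₁` for `n = 3`: `(6·I₀ − 5·I₃²)/(4·I₂ + I₃²)`. -/
noncomputable def F1n3 (q : ℂ → (Fin 3 → ℂ)) (z : ℂ) : ℂ :=
  (6 * I0inv 3 q z - 5 * (Iinv 3 q 2 z) ^ 2) / (4 * Iinv 3 q 1 z + (Iinv 3 q 2 z) ^ 2)

/-- `F₂` for `n = 3`: `(36·I₁ + 6·I₂·I₃ + I₃³)²/(4·I₂ + I₃²)³`. -/
noncomputable def F2n3 (q : ℂ → (Fin 3 → ℂ)) (z : ℂ) : ℂ :=
  (36 * Iinv 3 q 0 z + 6 * Iinv 3 q 1 z * Iinv 3 q 2 z + (Iinv 3 q 2 z) ^ 3) ^ 2 /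
    (4 * Iinv 3 q 1 z + (Iinv 3 q 2 z) ^ 2) ^ 3

open Filter Topology

/-- Derivative of the building blocks `(cz+d)⁻ᵐ • u(φ(z))` of the derivatives of `q ∘ φ`. -/
theorem hasDerivAt_inv_pow_smul_comp {E : Type*} [NormedAddCommGroup E] [NormedSpace ℂ E]
    {a b c d z : ℂ} {φ : ℂ → ℂ} (hφ : ∀ z, φ z = (a * z + b) / (c * z + d))
    (hz : c * z + d ≠ 0) {u : ℂ → E} (hu : DifferentiableAt ℂ u (φ z)) (m : ℕ) :
    HasDerivAt (fun x => (c * x + d)⁻¹ ^ m • u (φ x))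
      ((c * z + d)⁻¹ ^ m • ((a * d - b * c) * (c * z + d)⁻¹ ^ 2) • deriv u (φ z) +
        (-(m * c * (c * z + d)⁻¹ ^ (m + 1))) • u (φ z)) z := by
  have hlin (α β : ℂ) : HasDerivAt (fun x : ℂ => α * x + β) α z := by
    simpa using ((hasDerivAt_id z).const_mul α).add_const β
  have hφ' : HasDerivAt φ ((a * d - b * c) * (c * z + d)⁻¹ ^ 2) z := by
    rw [funext hφ]
    refine ((hlin a b).fun_div (hlin c d) hz).congr_deriv ?_
    field_simp
    ring
  have hpow : HasDerivAt (fun x => (c * x + d)⁻¹ ^ m) (-(m * c * (c * z + d)⁻¹ ^ (m + 1))) z := by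
    refine (((hlin c d).fun_inv hz).fun_pow m).congr_deriv ?_
    rcases m with _ | m
    · simp
    · simp only [Nat.add_sub_cancel, pow_succ]
      field_simp
  exact hpow.fun_smul (hu.hasDerivAt.scomp z hφ')

/-- The first five derivatives of `q ∘ φ` for a Möbius transformation `φ`, where
`p = φ'(z)` and `s = c / (cz+d)`. -/
theorem iteratedDeriv_comp_moebius {E : Type*} [NormedAddCommGroup E] [NormedSpace ℂ E]
    [CompleteSpace E] {V : Set ℂ} (hV : IsOpen V) {q : ℂ → E} (hq : ∀ w ∈ V, AnalyticAt ℂ q w)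
    {a b c d z : ℂ} {φ : ℂ → ℂ} (hφ : ∀ z, φ z = (a * z + b) / (c * z + d))
    (hz : c * z + d ≠ 0) (hzV : φ z ∈ V) {p s : ℂ}
    (hp : p = (a * d - b * c) * (c * z + d)⁻¹ ^ 2) (hs : s = c * (c * z + d)⁻¹) :
    iteratedDeriv 1 (q ∘ φ) z = p • iteratedDeriv 1 q (φ z) ∧
    iteratedDeriv 2 (q ∘ φ) z =
      p ^ 2 • iteratedDeriv 2 q (φ z) - (2 * s * p) • iteratedDeriv 1 q (φ z) ∧
    iteratedDeriv 3 (q ∘ φ) z =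
      p ^ 3 • iteratedDeriv 3 q (φ z) - (6 * s * p ^ 2) • iteratedDeriv 2 q (φ z) +
        (6 * s ^ 2 * p) • iteratedDeriv 1 q (φ z) ∧
    iteratedDeriv 4 (q ∘ φ) z =
      p ^ 4 • iteratedDeriv 4 q (φ z) - (12 * s * p ^ 3) • iteratedDeriv 3 q (φ z) +
        (36 * s ^ 2 * p ^ 2) • iteratedDeriv 2 q (φ z) -
        (24 * s ^ 3 * p) • iteratedDeriv 1 q (φ z) ∧
    iteratedDeriv 5 (q ∘ φ) z =
      p ^ 5 • iteratedDeriv 5 q (φ z) - (20 * s * p ^ 4) • iteratedDeriv 4 q (φ z) +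
        (120 * s ^ 2 * p ^ 3) • iteratedDeriv 3 q (φ z) -
        (240 * s ^ 3 * p ^ 2) • iteratedDeriv 2 q (φ z) +
        (120 * s ^ 4 * p) • iteratedDeriv 1 q (φ z) := by
  set D := a * d - b * c with hD
  let W : Set ℂ := {x | c * x + d ≠ 0 ∧ φ x ∈ V}
  have hcont (x : ℂ) (hx : c * x + d ≠ 0) : ContinuousAt φ x := by
    rw [funext hφ]
    fun_prop (disch := exact hx)
  have hW {x : ℂ} (hx : x ∈ W) : ∀ᶠ y in 𝓝 x, y ∈ W :=
    ((by fun_prop : ContinuousAt (fun y : ℂ => c * y + d) x).eventually_ne hx.1).and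
      ((hcont x hx.1).eventually (hV.mem_nhds hx.2))
  have hterm {x : ℂ} (hx : x ∈ W) (k m : ℕ) :
      HasDerivAt (fun y => (c * y + d)⁻¹ ^ m • iteratedDeriv k q (φ y))
        ((c * x + d)⁻¹ ^ m • (D * (c * x + d)⁻¹ ^ 2) • iteratedDeriv (k + 1) q (φ x) +
          (-(m * c * (c * x + d)⁻¹ ^ (m + 1))) • iteratedDeriv k q (φ x)) x := by
    have hk : DifferentiableAt ℂ (iteratedDeriv k q) (φ x) := by
      rw [iteratedDeriv_eq_iterate]
      exact ((hq _ hx.2).iterated_deriv k).differentiableAt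
    rw [iteratedDeriv_succ]
    exact hasDerivAt_inv_pow_smul_comp hφ hx.1 hk m
  have hstep {k : ℕ} {f : ℂ → E} (hf : ∀ x ∈ W, iteratedDeriv k (q ∘ φ) x = f x)
      {x : ℂ} (hx : x ∈ W) {f' : E} (hf' : HasDerivAt f f' x) :
      iteratedDeriv (k + 1) (q ∘ φ) x = f' := by
    rw [iteratedDeriv_succ]
    exact (hf'.congr_of_eventuallyEq ((hW hx).mono hf)).deriv
  have h0 : ∀ x ∈ W, iteratedDeriv 0 (q ∘ φ) x =
      (c * x + d)⁻¹ ^ 0 • iteratedDeriv 0 q (φ x) := by simp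
  have h1 : ∀ x ∈ W, iteratedDeriv 1 (q ∘ φ) x =
      D • ((c * x + d)⁻¹ ^ 2 • iteratedDeriv 1 q (φ x)) := by
    intro x hx
    rw [hstep h0 hx (hterm hx 0 0)]
    push_cast
    module
  have h2 : ∀ x ∈ W, iteratedDeriv 2 (q ∘ φ) x =
      D ^ 2 • ((c * x + d)⁻¹ ^ 4 • iteratedDeriv 2 q (φ x)) +
        (-2 * c * D) • ((c * x + d)⁻¹ ^ 3 • iteratedDeriv 1 q (φ x)) := by
    intro x hx
    rw [hstep h1 hx ((hterm hx 1 2).fun_const_smul D)]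
    push_cast
    module
  have h3 : ∀ x ∈ W, iteratedDeriv 3 (q ∘ φ) x =
      D ^ 3 • ((c * x + d)⁻¹ ^ 6 • iteratedDeriv 3 q (φ x)) +
        (-6 * c * D ^ 2) • ((c * x + d)⁻¹ ^ 5 • iteratedDeriv 2 q (φ x)) +
        (6 * c ^ 2 * D) • ((c * x + d)⁻¹ ^ 4 • iteratedDeriv 1 q (φ x)) := by
    intro x hx
    rw [hstep h2 hx (((hterm hx 2 4).fun_const_smul _).fun_add ((hterm hx 1 3).fun_const_smul _))]
    push_cast
    module
  have h4 : ∀ x ∈ W, iteratedDeriv 4 (q ∘ φ) x =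
      D ^ 4 • ((c * x + d)⁻¹ ^ 8 • iteratedDeriv 4 q (φ x)) +
        (-12 * c * D ^ 3) • ((c * x + d)⁻¹ ^ 7 • iteratedDeriv 3 q (φ x)) +
        (36 * c ^ 2 * D ^ 2) • ((c * x + d)⁻¹ ^ 6 • iteratedDeriv 2 q (φ x)) +
        (-24 * c ^ 3 * D) • ((c * x + d)⁻¹ ^ 5 • iteratedDeriv 1 q (φ x)) := by
    intro x hx
    rw [hstep h3 hx ((((hterm hx 3 6).fun_const_smul _).fun_add
      ((hterm hx 2 5).fun_const_smul _)).fun_add ((hterm hx 1 4).fun_const_smul _))]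
    push_cast
    module
  have hzW : z ∈ W := ⟨hz, hzV⟩
  refine ⟨?_, ?_, ?_, ?_, ?_⟩
  · rw [h1 z hzW, hp]
    module
  · rw [h2 z hzW, hp, hs]
    module
  · rw [h3 z hzW, hp, hs]
    module
  · rw [h4 z hzW, hp, hs]
    module
  · rw [hstep h4 hzW (((((hterm hzW 4 8).fun_const_smul _).fun_add
      ((hterm hzW 3 7).fun_const_smul _)).fun_add ((hterm hzW 2 6).fun_const_smul _)).fun_add
      ((hterm hzW 1 5).fun_const_smul _)), hp, hs]
    push_cast
    module

/-- Transformation rules of `I₀, I₁, I₂, I₃` for `n = 3` under a Möbius change of parameter. -/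
theorem invariants_comp_moebius {V : Set ℂ} (hV : IsOpen V)
    {q : ℂ → (Fin 3 → ℂ)} (hq : ∀ w ∈ V, AnalyticAt ℂ q w)
    {a b c d z : ℂ} (h : a * d - b * c ≠ 0)
    {φ : ℂ → ℂ} (hφ : ∀ z, φ z = (a * z + b) / (c * z + d))
    (hz : c * z + d ≠ 0) (hzV : φ z ∈ V) (hΔ : Δmat 3 q (φ z) ≠ 0) :
    ∃ p s : ℂ, p ≠ 0 ∧
      Iinv 3 (q ∘ φ) 2 z = p * Iinv 3 q 2 (φ z) - 12 * s ∧
      Iinv 3 (q ∘ φ) 1 z =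
        p ^ 2 * Iinv 3 q 1 (φ z) + 6 * s * p * Iinv 3 q 2 (φ z) - 36 * s ^ 2 ∧
      Iinv 3 (q ∘ φ) 0 z =
        p ^ 3 * Iinv 3 q 0 (φ z) + 2 * s * p ^ 2 * Iinv 3 q 1 (φ z) +
          6 * s ^ 2 * p * Iinv 3 q 2 (φ z) - 24 * s ^ 3 ∧
      I0inv 3 (q ∘ φ) z =
        p ^ 2 * I0inv 3 q (φ z) - 20 * s * p * Iinv 3 q 2 (φ z) + 120 * s ^ 2 := by
  obtain ⟨p, hp⟩ : ∃ p, p = (a * d - b * c) * (c * z + d)⁻¹ ^ 2 := ⟨_, rfl⟩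
  obtain ⟨s, hs⟩ : ∃ s, s = c * (c * z + d)⁻¹ := ⟨_, rfl⟩
  have hp0 : p ≠ 0 := hp ▸ mul_ne_zero h (pow_ne_zero _ (inv_ne_zero hz))
  obtain ⟨e1, e2, e3, e4, e5⟩ := iteratedDeriv_comp_moebius hV hq hφ hz hzV hp hs
  have hΔ' : Δmat 3 (q ∘ φ) z = p ^ 6 * Δmat 3 q (φ z) := by
    simp [Δmat, Dmat, Matrix.det_fin_three, e1, e2, e3]
    ring
  refine ⟨p, s, hp0, ?_, ?_, ?_, ?_⟩
  all_goals
    simp only [Iinv, I0inv, hΔ']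
    field_simp
    simp [Ainv, Δmat, Dmat, Matrix.det_fin_three, e1, e2, e3, e4, e5]
    ring


/-- for `n = 3`, the invariants `F₁` and `F₂` are Möbius-commuting. -/
theorem F1_F2_moebius_commuting_n3 (V : Set ℂ) (hV : IsOpen V)
    (q : ℂ → (Fin 3 → ℂ)) (hq : ∀ w ∈ V, AnalyticAt ℂ q w)
    (a b c d : ℂ) (h : a * d - b * c ≠ 0)
    (φ : ℂ → ℂ) (hφ : ∀ z, φ z = (a * z + b) / (c * z + d))
    (z : ℂ) (hz : c * z + d ≠ 0) (hzV : φ z ∈ V) (hΔ : Δmat 3 q (φ z) ≠ 0)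
    (hden₁ : 4 * Iinv 3 (q ∘ φ) 1 z + (Iinv 3 (q ∘ φ) 2 z) ^ 2 ≠ 0)
    (hden₂ : 4 * Iinv 3 q 1 (φ z) + (Iinv 3 q 2 (φ z)) ^ 2 ≠ 0) :
    F1n3 (q ∘ φ) z = F1n3 q (φ z) ∧ F2n3 (q ∘ φ) z = F2n3 q (φ z) := by
  obtain ⟨p, s, hp, h3, h2, h1, h0⟩ := invariants_comp_moebius hV hq h hφ hz hzV hΔ
  have hden : 4 * Iinv 3 (q ∘ φ) 1 z + (Iinv 3 (q ∘ φ) 2 z) ^ 2 =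
      p ^ 2 * (4 * Iinv 3 q 1 (φ z) + (Iinv 3 q 2 (φ z)) ^ 2) := by
    rw [h2, h3]
    ring
  have hnum₁ : 6 * I0inv 3 (q ∘ φ) z - 5 * (Iinv 3 (q ∘ φ) 2 z) ^ 2 =
      p ^ 2 * (6 * I0inv 3 q (φ z) - 5 * (Iinv 3 q 2 (φ z)) ^ 2) := by
    rw [h0, h3]
    ring
  have hnum₂ : 36 * Iinv 3 (q ∘ φ) 0 z + 6 * Iinv 3 (q ∘ φ) 1 z * Iinv 3 (q ∘ φ) 2 z +
      (Iinv 3 (q ∘ φ) 2 z) ^ 3 =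
      p ^ 3 * (36 * Iinv 3 q 0 (φ z) + 6 * Iinv 3 q 1 (φ z) * Iinv 3 q 2 (φ z) +
        (Iinv 3 q 2 (φ z)) ^ 3) := by
    rw [h1, h2, h3]
    ring
  refine ⟨?_, ?_⟩
  · rw [F1n3, F1n3, hnum₁, hden, mul_div_mul_left _ _ (pow_ne_zero 2 hp)]
  · rw [F2n3, F2n3, hnum₂, hden, mul_pow, mul_pow, ← pow_mul, ← pow_mul,
      mul_div_mul_left _ _ (pow_ne_zero 6 hp)]
end
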